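/- Let F be a nonarchimedean local field with ring of integers O, uniformizer ϖ, and residue field of cardinality q. Let K = GL_n(O) ⊂ G = GL_n(F). For dominant cocharacters λ, λ' (i.e., λ = diag(ϖ^{a₁},...,ϖ^{a_n}) with a₁ ≥ ... ≥ a_n, similarly λ'), one has the inclusion K λ K λ⁻¹ ∩ K (λ')⁻¹ K λ' ⊆ K. -/

import Mathlib

open scoped BigOperators

/-- A weight summed over the image of an injection is at most its sum over a set on which the
weight is uniformly largest. -/
theorem sum_comp_le_sum_comp_of_threshold {ι α : Type*} [Fintype α] [DecidableEq α]
    (P : Finset ι) (e f : ι → α) (he : Set.InjOn e P) (hf : Set.InjOn f P)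
    (w : α → ℤ) (t : ℤ) (hin : ∀ q ∈ P, t ≤ w (e q)) (hout : ∀ p ∉ P.image e, w p ≤ t) :
    ∑ q ∈ P, w (f q) ≤ ∑ q ∈ P, w (e q) := by
  have h : ∑ q ∈ P, (w (f q) - t) ≤ ∑ q ∈ P, (w (e q) - t) := by
    calc ∑ q ∈ P, (w (f q) - t)
        ≤ ∑ q ∈ P, max (w (f q) - t) 0 := Finset.sum_le_sum fun q _ => le_max_left _ _
      _ = ∑ p ∈ P.image f, max (w p - t) 0 :=
          (Finset.sum_image (f := fun p => max (w p - t) 0) hf).symm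
      _ ≤ ∑ p, max (w p - t) 0 :=
          Finset.sum_le_sum_of_subset_of_nonneg (Finset.subset_univ _)
            fun _ _ _ => le_max_right _ _
      _ = ∑ p ∈ P.image e, max (w p - t) 0 := by
          refine (Finset.sum_subset (Finset.subset_univ _) fun p _ hp => ?_).symm
          exact max_eq_right (by linarith [hout p hp])
      _ = ∑ q ∈ P, max (w (e q) - t) 0 :=
          Finset.sum_image (f := fun p => max (w p - t) 0) he
      _ = ∑ q ∈ P, (w (e q) - t) :=
          Finset.sum_congr rfl fun q hq => max_eq_left (by linarith [hin q hq])
  simpa [Finset.sum_sub_distrib] using h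

theorem prod_zpow_eq_zpow_sum₀ {ι F : Type*} [Field F] {x : F} (hx : x ≠ 0) (P : Finset ι)
    (c : ι → ℤ) : ∏ q ∈ P, x ^ c q = x ^ ∑ q ∈ P, c q := by
  classical
  induction P using Finset.induction_on with
  | empty => simp
  | insert q P hq ih => rw [Finset.prod_insert hq, Finset.sum_insert hq, ih, zpow_add₀ hx]

section Valuation

variable {F Γ : Type*} [Field F] [LinearOrderedCommGroupWithZero Γ] (v : Valuation F Γ)

theorem Valuation.map_zpow_le_one {x : F} (hx : v x ≤ 1) {k : ℤ} (hk : 0 ≤ k) :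
    v (x ^ k) ≤ 1 := by
  lift k to ℕ using hk
  simpa using pow_le_one₀ zero_le hx

theorem Valuation.map_prod_le_one {ι : Type*} (P : Finset ι) (c : ι → F)
    (hc : ∀ q ∈ P, v (c q) ≤ 1) : v (∏ q ∈ P, c q) ≤ 1 :=
  Subring.prod_mem v.integer hc

theorem Valuation.map_det_le_one {ι : Type*} [Fintype ι] [DecidableEq ι] (M : Matrix ι ι F)
    (hM : ∀ i j, v (M i j) ≤ 1) : v M.det ≤ 1 := by
  let M' : Matrix ι ι v.integer := Matrix.of fun i j => ⟨M i j, hM i j⟩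
  have h : M = M'.map v.integer.subtype := rfl
  have h' : v.integer.subtype M'.det = M.det := by
    rw [h, RingHom.map_det]; rfl
  rw [← h']
  exact M'.det.2

theorem Valuation.map_det_le_one_of_row_sums {ι α : Type*} [Fintype ι] [DecidableEq ι] [Fintype α]
    (N : Matrix ι ι F) (c : ι → α → F) (E : ι → α → ι → F)
    (hN : ∀ q, N q = ∑ p, c q p • E q p)
    (h : ∀ f : ι → α, v ((∏ q, c q (f q)) * (Matrix.of fun q => E q (f q)).det) ≤ 1) :
    v N.det ≤ 1 := by
  classical
  have hdet : N.det = ∑ f : ι → α, (∏ q, c q (f q)) * (Matrix.of fun q => E q (f q)).det := by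
    have hN' : N = fun q => ∑ p, c q p • E q p := funext hN
    rw [hN']
    refine ((Matrix.detRowAlternating (R := F) (n := ι)).toMultilinearMap.map_sum
      fun q p => c q p • E q p).trans (Finset.sum_congr rfl fun f _ => ?_)
    exact (Matrix.detRowAlternating (R := F) (n := ι)).toMultilinearMap.map_smul_univ _ _
  rw [hdet]
  exact v.map_sum_le fun f _ => h f

/-- A product of integral multiples of powers of `x` is integral if the exponents are differences
of weights along two injections, the first of which hits the largest weights. -/
theorem Valuation.map_prod_zpow_mul_le_one {ι α : Type*} [Fintype α] [DecidableEq α] {x : F}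
    (hx0 : x ≠ 0) (hx : v x ≤ 1) (P : Finset ι) (e f : ι → α) (he : Set.InjOn e P)
    (hf : Set.InjOn f P) (w : α → ℤ) (t : ℤ) (hin : ∀ q ∈ P, t ≤ w (e q))
    (hout : ∀ p ∉ P.image e, w p ≤ t) (u : ι → F) (hu : ∀ q ∈ P, v (u q) ≤ 1) :
    v (∏ q ∈ P, x ^ (w (e q) - w (f q)) * u q) ≤ 1 := by
  rw [Finset.prod_mul_distrib, prod_zpow_eq_zpow_sum₀ hx0, map_mul]
  refine mul_le_one' (v.map_zpow_le_one hx ?_) (v.map_prod_le_one P u hu)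
  rw [Finset.sum_sub_distrib]
  exact sub_nonneg.2 (sum_comp_le_sum_comp_of_threshold P e f he hf w t hin hout)

/-- The entry `g i j` appears in the determinant of `g` bordered by its `j`-th column and the
truncation of its `i`-th row. -/
theorem Matrix.det_bordered {n : ℕ} (g : Matrix (Fin n) (Fin n) F) (hg : IsUnit g.det)
    (i j : Fin n) :
    (Matrix.fromBlocks g (Matrix.of fun r (_ : Unit) => g r j)
      (Matrix.of fun (_ : Unit) r => if r ≤ j then g i r else 0) 0).det = -(g.det * g i j) := by
  let := g.invertibleOfIsUnitDet hg
  have hcol : (⅟g * Matrix.of fun r (_ : Unit) => g r j) =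
      Matrix.of fun r (_ : Unit) => (1 : Matrix (Fin n) (Fin n) F) r j := by
    ext r s
    rw [← invOf_mul_self g]
    rfl
  rw [Matrix.det_fromBlocks₁₁, Matrix.mul_assoc, hcol]
  simp [Matrix.mul_apply, Matrix.one_apply]

set_option maxHeartbeats 800000 in
/-- If `g = A ϖ^a B ϖ^(-a) = C ϖ^(-b) D ϖ^b` with `A`, `B`, `C`, `D` integral and `a`, `b` antitone,
then `g` is integral up to its determinant. -/
theorem Valuation.map_det_mul_apply_le_one {n : ℕ} {ϖ : F} (h0 : ϖ ≠ 0) (h1 : v ϖ ≤ 1)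
    {a b : Fin n → ℤ} (ha : Antitone a) (hb : Antitone b) (g A B C D : Matrix (Fin n) (Fin n) F)
    (hg : IsUnit g.det)
    (hA : ∀ i j, v (A i j) ≤ 1) (hB : ∀ i j, v (B i j) ≤ 1)
    (hC : ∀ i j, v (C i j) ≤ 1) (hD : ∀ i j, v (D i j) ≤ 1)
    (hAB : ∀ r q, g r q = ∑ p, ϖ ^ (a p - a q) * B p q * A r p)
    (hCD : ∀ r q, g r q = ∑ p, ϖ ^ (b q - b p) * D p q * C r p) (i j : Fin n) :
    v (g.det * g i j) ≤ 1 := by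
  rw [← v.map_neg, ← Matrix.det_bordered g hg i j, ← Matrix.det_transpose]
  let e : Fin n ⊕ Unit → Fin n := Sum.elim id fun _ => j
  let S : Fin n ⊕ Unit → Prop := Sum.elim (· ≤ j) fun _ => False
  classical
  refine v.map_det_le_one_of_row_sums _
    (fun q p => if S q then ϖ ^ (b (e q) - b p) * D p (e q) else ϖ ^ (a p - a (e q)) * B p (e q))
    (fun q p => if S q then Sum.elim (fun r => C r p) (fun _ => C i p)
      else Sum.elim (fun r => A r p) (fun _ => 0)) ?_ ?_
  · rintro (q | q) <;> ext (r | r)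
    · by_cases h : q ≤ j
      · simpa [S, e, h] using hCD r q
      · simpa [S, e, h] using hAB r q
    · by_cases h : q ≤ j
      · simpa [S, e, h] using hCD i q
      · simp [S, e, h]
    · simpa [S, e] using hAB r j
    · simp [S, e]
  · intro f
    by_cases hinj : ∀ q q', q ≠ q' → (S q ↔ S q') → f q ≠ f q'
    · rw [map_mul]
      refine mul_le_one' ?_ (v.map_det_le_one _ ?_)
      · rw [← Finset.prod_filter_mul_prod_filter_not Finset.univ S, map_mul]
        refine mul_le_one' ?_ ?_
        · rw [Finset.prod_congr rfl fun q hq => if_pos (Finset.mem_filter.1 hq).2]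
          refine v.map_prod_zpow_mul_le_one h0 h1 _ e f ?_ ?_ b (b j) ?_ ?_ _ fun q _ => hD _ _
          · rintro (q | q) hq (q' | q') hq' h <;> simp_all [S, e]
          · intro q hq q' hq' h
            by_contra hne
            exact hinj q q' hne (by simp_all) h
          · rintro (q | q) hq
            · have hq' : q ≤ j := by simpa [S] using hq
              exact hb hq'
            · simp [S] at hq
          · intro p hp
            refine hb (le_of_not_ge fun h => hp ?_)
            exact Finset.mem_image.2 ⟨Sum.inl p, by simpa [S] using h, rfl⟩
        · rw [Finset.prod_congr rfl fun q hq => if_neg (Finset.mem_filter.1 hq).2]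
          have key := v.map_prod_zpow_mul_le_one h0 h1 (Finset.univ.filter fun q => ¬ S q) e f
            ?_ ?_ (fun p => - a p) (- a j) ?_ ?_ (fun q => B (f q) (e q)) fun q _ => hB _ _
          · simpa only [neg_sub_neg] using key
          · rintro (q | q) hq (q' | q') hq' h <;> simp_all [S, e]
          · intro q hq q' hq' h
            by_contra hne
            exact hinj q q' hne (by simp_all) h
          · rintro (q | q) hq
            · have hq' : j < q := by simpa [S] using hq
              exact neg_le_neg (ha hq'.le)
            · exact le_rfl
          · intro p hp
            refine neg_le_neg (ha (le_of_not_ge fun h => hp ?_))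
            rcases h.eq_or_lt with rfl | h
            · exact Finset.mem_image.2 ⟨Sum.inr (), by simp [S], rfl⟩
            · exact Finset.mem_image.2 ⟨Sum.inl p, by simpa [S] using h, rfl⟩
      · intro q r
        rw [Matrix.of_apply]
        split_ifs
        · cases r <;> exact hC _ _
        · cases r
          · exact hA _ _
          · simp
    · push Not at hinj
      obtain ⟨q, q', hne, hS, hf⟩ := hinj
      rw [Matrix.det_zero_of_row_eq hne (by funext r; simp only [Matrix.of_apply, hS, hf]), mul_zero, map_zero]
      exact zero_le_one

theorem Valuation.map_det_eq_one {n : ℕ} (k : GL (Fin n) F)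
    (hk : ∀ i j, v ((k : Matrix (Fin n) (Fin n) F) i j) ≤ 1)
    (hk' : ∀ i j, v (((k⁻¹ : GL (Fin n) F) : Matrix (Fin n) (Fin n) F) i j) ≤ 1) :
    v (k : Matrix (Fin n) (Fin n) F).det = 1 := by
  have h : v (k : Matrix (Fin n) (Fin n) F).det *
      v ((k⁻¹ : GL (Fin n) F) : Matrix (Fin n) (Fin n) F).det = 1 := by
    rw [← map_mul, ← Matrix.det_mul, ← Units.val_mul, mul_inv_cancel]
    simp
  refine le_antisymm (v.map_det_le_one _ hk) ?_
  rw [← h]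
  exact mul_le_of_le_one_right' (v.map_det_le_one _ hk')

theorem Valuation.map_inv_apply_le_one {n : ℕ} (g : GL (Fin n) F)
    (hg : ∀ i j, v ((g : Matrix (Fin n) (Fin n) F) i j) ≤ 1)
    (hdet : v (g : Matrix (Fin n) (Fin n) F).det = 1) (i j : Fin n) :
    v (((g⁻¹ : GL (Fin n) F) : Matrix (Fin n) (Fin n) F) i j) ≤ 1 := by
  rw [Matrix.coe_units_inv, Matrix.inv_def, Matrix.smul_apply, smul_eq_mul, map_mul,
    Ring.inverse_eq_inv', map_inv₀, hdet, inv_one, one_mul, Matrix.adjugate_apply]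
  refine v.map_det_le_one _ fun r s => ?_
  rw [Matrix.updateRow_apply]
  split_ifs
  · by_cases h : s = i
    · subst h; simp
    · simp [h]
  · exact hg r s

theorem Matrix.GeneralLinearGroup.coe_inv_of_coe_eq_diagonal_zpow {n : ℕ} {x : F} (hx : x ≠ 0)
    {c : Fin n → ℤ} {L : GL (Fin n) F}
    (hL : (L : Matrix (Fin n) (Fin n) F) = Matrix.diagonal fun i => x ^ c i) :
    ((L⁻¹ : GL (Fin n) F) : Matrix (Fin n) (Fin n) F) = Matrix.diagonal fun i => x ^ (-c i) := by
  rw [Matrix.coe_units_inv, hL]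
  refine Matrix.inv_eq_right_inv ?_
  simp [Matrix.diagonal_mul_diagonal, zpow_ne_zero _ hx]

end Valuation

theorem stmt11 {F : Type*} [Field F]
    (v : Valuation F (WithZero (Multiplicative ℤ)))
    (ϖ : F)
    (hϖ : v ϖ = ((Multiplicative.ofAdd (-1 : ℤ) : Multiplicative ℤ) :
      WithZero (Multiplicative ℤ)))
    (n : ℕ) (hn : 1 ≤ n)
    (a b : Fin n → ℤ)
    (ha : ∀ i j : Fin n, i ≤ j → a j ≤ a i)
    (hb : ∀ i j : Fin n, i ≤ j → b j ≤ b i)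
    (Λ Λ' : GL (Fin n) F)
    (hΛ : (Λ : Matrix (Fin n) (Fin n) F) = Matrix.diagonal fun i => ϖ ^ (a i))
    (hΛ' : (Λ' : Matrix (Fin n) (Fin n) F) = Matrix.diagonal fun i => ϖ ^ (b i))
    (K : Set (GL (Fin n) F))
    (hK : K = {g : GL (Fin n) F |
      (∀ i j : Fin n, v ((g : Matrix (Fin n) (Fin n) F) i j) ≤ 1) ∧
      (∀ i j : Fin n, v (((g⁻¹ : GL (Fin n) F) : Matrix (Fin n) (Fin n) F) i j) ≤ 1)})
    (x : GL (Fin n) F)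
    (h1 : ∃ k₁ ∈ K, ∃ k₂ ∈ K, x = k₁ * Λ * k₂ * Λ⁻¹)
    (h2 : ∃ k₃ ∈ K, ∃ k₄ ∈ K, x = k₃ * Λ'⁻¹ * k₄ * Λ') :
    x ∈ K := by
  subst hK
  obtain ⟨k₁, hk₁, k₂, hk₂, h1⟩ := h1
  obtain ⟨k₃, hk₃, k₄, hk₄, h2⟩ := h2
  have h0 : ϖ ≠ 0 := by
    rintro rfl
    simp at hϖ
  have hle : v ϖ ≤ 1 := by
    rw [hϖ, ← WithZero.coe_one, WithZero.coe_le_coe, ← ofAdd_zero, Multiplicative.ofAdd_le]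
    norm_num
  have hΛi := Matrix.GeneralLinearGroup.coe_inv_of_coe_eq_diagonal_zpow h0 hΛ
  have hΛi' := Matrix.GeneralLinearGroup.coe_inv_of_coe_eq_diagonal_zpow h0 hΛ'
  have hdet : v (x : Matrix (Fin n) (Fin n) F).det = 1 := by
    have hx : (x : Matrix (Fin n) (Fin n) F).det =
        (k₁ : Matrix (Fin n) (Fin n) F).det * (k₂ : Matrix (Fin n) (Fin n) F).det := by
      have hu := congrArg Matrix.GeneralLinearGroup.det h1
      rw [map_mul, map_mul, map_mul, map_inv, mul_right_comm, mul_inv_cancel_right] at hu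
      exact congrArg Units.val hu
    rw [hx, map_mul, v.map_det_eq_one k₁ hk₁.1 hk₁.2, v.map_det_eq_one k₂ hk₂.1 hk₂.2, one_mul]
  have hint : ∀ i j, v ((x : Matrix (Fin n) (Fin n) F) i j) ≤ 1 := by
    intro i j
    have key := v.map_det_mul_apply_le_one h0 hle (fun i j h => ha i j h) (fun i j h => hb i j h)
      (x : Matrix (Fin n) (Fin n) F) k₁ k₂ k₃ k₄
      ((Matrix.isUnit_iff_isUnit_det _).1 x.isUnit) hk₁.1 hk₂.1 hk₃.1 hk₄.1 ?_ ?_ i j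
    · rwa [map_mul, hdet, one_mul] at key
    · intro r q
      rw [h1, Units.val_mul, Units.val_mul, Units.val_mul, hΛ, hΛi, Matrix.mul_diagonal,
        Matrix.mul_apply, Finset.sum_mul]
      refine Finset.sum_congr rfl fun p _ => ?_
      rw [Matrix.mul_diagonal, sub_eq_add_neg, zpow_add₀ h0]
      ring
    · intro r q
      rw [h2, Units.val_mul, Units.val_mul, Units.val_mul, hΛ', hΛi', Matrix.mul_diagonal,
        Matrix.mul_apply, Finset.sum_mul]
      refine Finset.sum_congr rfl fun p _ => ?_
      rw [Matrix.mul_diagonal, sub_eq_add_neg, zpow_add₀ h0]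
      ring
  exact ⟨hint, v.map_inv_apply_le_one x hint hdet⟩
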